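/- arXiv:2006.00997 — 5 statements merged into one kernel-verified Lean document; each statement's English description precedes it below -/
import Mathlib

section
/- Let Σ be a real symmetric positive-definite n×n matrix with largest eigenvalue λ_M and smallest eigenvalue λ_m, and set κ = √(λ_M/λ_m). Let A be a real n×n matrix with A + Aᵀ ⪯ −γ I for some γ > 0. Let ΔA : [0,∞) → ℝ^{n×n} and Δ : [0,∞) → ℝⁿ be continuous, and let c : [0,∞) → ℝⁿ be continuously differentiable and satisfy the ODE ċ_t = (Σ⁻¹A + ΔA_t) c_t + Δ_t for all t ≥ 0. Then for every ε with 0 < ε < γ/λ_M and every t ≥ 0, |c_t|² ≤ (λ_M/λ_m) · exp( −(γ/λ_M − ε) t + 2κ ∫₀ᵗ |ΔA_s| ds ) · |c₀|² + (λ_M/(ε λ_m)) · ∫₀ᵗ exp( −(γ/λ_M − ε)(t−s) + 2κ ∫_sᵗ |ΔA_τ| dτ ) · |Δ_s|² ds. -/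
open MeasureTheory intervalIntegral Matrix

/-- Operator norm of a matrix, induced by the Euclidean norm. -/
noncomputable def opNorm {n : ℕ} (M : Matrix (Fin n) (Fin n) ℝ) : ℝ :=
  ‖Matrix.toEuclideanCLM (𝕜 := ℝ) M‖

theorem aux_ineq {E : Type*} [NormedAddCommGroup E] [InnerProductSpace ℝ E]
   (S : E →L[ℝ] E) (hsym : ∀ x y, inner ℝ (S x) y = inner ℝ x (S y)) (hpos : ∀ x, 0 ≤ inner ℝ (S x) x)
   (θ : ℝ) (hθ : 0 < θ) (x y : E) :
   2 * inner ℝ (S x) y ≤ θ * inner ℝ (S x) x + (1/θ) * inner ℝ (S y) y := by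
  have h := hpos (θ • x - y)
  have h2 : inner ℝ (S y) x = inner ℝ (S x) y := by rw [hsym, real_inner_comm]
  simp only [map_sub, map_smul, inner_sub_left, inner_sub_right, inner_smul_left, inner_smul_right, h2, RCLike.conj_to_real] at h
  have : θ * inner ℝ (S x) x + (1/θ) * inner ℝ (S y) y - 2 * inner ℝ (S x) y = (1/θ) * (θ * (θ * inner ℝ (S x) x) - θ * inner ℝ (S x) y - (θ * inner ℝ (S x) y - inner ℝ (S y) y)) := by
    field_simp; ring
  have := mul_nonneg (one_div_pos.2 hθ).le h
  linarith

theorem aux_gron (V V' h g : ℝ → ℝ) (hh : Continuous h) (hg : Continuous g)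
   (hV : ∀ t, 0 ≤ t → HasDerivAt V (V' t) t) (hle : ∀ t, 0 ≤ t → V' t ≤ h t * V t + g t)
   (t : ℝ) (ht : 0 ≤ t) :
   V t ≤ Real.exp (∫ s in (0:ℝ)..t, h s) * V 0 + ∫ s in (0:ℝ)..t, Real.exp (∫ τ in s..t, h τ) * g s := by
  set H : ℝ → ℝ := fun s => ∫ τ in (0:ℝ)..s, h τ with hH
  have dH : ∀ s, HasDerivAt H (h s) s := fun s => hh.integral_hasStrictDerivAt 0 s |>.hasDerivAt
  have cH : Continuous H := continuous_iff_continuousAt.2 fun s => (dH s).continuousAt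
  have ce : Continuous fun s => Real.exp (-H s) * g s := by fun_prop
  have dW : ∀ s, 0 ≤ s → HasDerivAt (fun s => Real.exp (-H s) * V s - ∫ τ in (0:ℝ)..s, Real.exp (-H τ) * g τ)
     ((Real.exp (-H s) * (-h s)) * V s + Real.exp (-H s) * V' s - Real.exp (-H s) * g s) s := fun s hs =>
    (((dH s).neg.exp).mul (hV s hs)).sub (ce.integral_hasStrictDerivAt 0 s |>.hasDerivAt)
  have anti : AntitoneOn (fun s => Real.exp (-H s) * V s - ∫ τ in (0:ℝ)..s, Real.exp (-H τ) * g τ) (Set.Ici 0) := by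
    apply antitoneOn_of_deriv_nonpos (convex_Ici 0)
    · exact fun s hs => (dW s hs).continuousAt.continuousWithinAt
    · intro s hs
      rw [interior_Ici] at hs
      exact (dW s hs.le).differentiableAt.differentiableWithinAt
    · intro s hs
      rw [interior_Ici] at hs
      rw [(dW s hs.le).deriv]
      have := mul_nonneg (Real.exp_pos (-H s)).le (sub_nonneg.2 (hle s hs.le))
      linarith
  have key := anti (Set.mem_Ici.2 le_rfl) (Set.mem_Ici.2 ht) ht
  have H0 : H 0 = 0 := by simp [hH]
  simp only [H0, neg_zero, Real.exp_zero, one_mul, integral_same, sub_zero] at key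
  have e1 : ∫ s in (0:ℝ)..t, Real.exp (∫ τ in s..t, h τ) * g s = Real.exp (H t) * ∫ s in (0:ℝ)..t, Real.exp (-H s) * g s := by
    rw [← intervalIntegral.integral_const_mul]
    congr 1; ext s
    rw [← mul_assoc, ← Real.exp_add]
    congr 2
    rw [← intervalIntegral.integral_interval_sub_left (a := 0) (hh.intervalIntegrable _ _) (hh.intervalIntegrable _ _)]
    ring
  rw [e1]
  have := mul_le_mul_of_nonneg_left key (Real.exp_pos (H t)).le
  have e2 : Real.exp (H t) * Real.exp (-H t) = 1 := by rw [← Real.exp_add]; simp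
  rw [mul_sub, ← mul_assoc, e2] at this
  linarith

open scoped MatrixOrder in
theorem aux_eig {n : ℕ} (Sig : Matrix (Fin n) (Fin n) ℝ) (h : Sig.IsHermitian) (a b : ℝ)
   (ha : ∀ i, a ≤ h.eigenvalues i) (hb : ∀ i, h.eigenvalues i ≤ b) :
   (Sig - a • 1).PosSemidef ∧ (b • 1 - Sig).PosSemidef := by
  have hs : IsSelfAdjoint Sig := h
  constructor
  · rw [← Matrix.le_iff, ← Algebra.algebraMap_eq_smul_one]
    refine algebraMap_le_of_le_spectrum ?_ hs
    rw [h.spectrum_real_eq_range_eigenvalues]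
    rintro _ ⟨i, rfl⟩; exact ha i
  · rw [← Matrix.le_iff, ← Algebra.algebraMap_eq_smul_one]
    refine le_algebraMap_of_spectrum_le ?_ hs
    rw [h.spectrum_real_eq_range_eigenvalues]
    rintro _ ⟨i, rfl⟩; exact hb i

theorem aux_psd {n : ℕ} (M : Matrix (Fin n) (Fin n) ℝ) (h : M.PosSemidef) (x : EuclideanSpace ℝ (Fin n)) :
   0 ≤ inner ℝ (Matrix.toEuclideanCLM (𝕜 := ℝ) M x) x := by
  have := h.dotProduct_mulVec_nonneg x.ofLp
  simpa [EuclideanSpace.inner_eq_star_dotProduct] using this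

theorem aux_tr {n : ℕ} (M : Matrix (Fin n) (Fin n) ℝ) (x y : EuclideanSpace ℝ (Fin n)) :
   inner ℝ (Matrix.toEuclideanCLM (𝕜 := ℝ) M x) y = inner ℝ x (Matrix.toEuclideanCLM (𝕜 := ℝ) Mᵀ y) := by
  simp [EuclideanSpace.inner_eq_star_dotProduct, Matrix.dotProduct_mulVec, Matrix.vecMul_transpose]
  simp [Matrix.mulVec_transpose, Matrix.dotProduct_mulVec]

theorem aux_cont {n : ℕ} : Continuous fun M : Matrix (Fin n) (Fin n) ℝ => ‖Matrix.toEuclideanCLM (𝕜 := ℝ) M‖ := by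
  have : Continuous (Matrix.toEuclideanCLM (n := Fin n) (𝕜 := ℝ)).toAlgEquiv.toLinearMap := LinearMap.continuous_of_finiteDimensional _
  exact this.norm

theorem stmt2 {n : ℕ} (Sig A : Matrix (Fin n) (Fin n) ℝ)
    (hSig : Sig.PosDef)
    (lamM lamm : ℝ)
    (hlamM : IsGreatest (Set.range hSig.1.eigenvalues) lamM)
    (hlamm : IsLeast (Set.range hSig.1.eigenvalues) lamm)
    (γ : ℝ) (hγ : 0 < γ)
    (hA : ((-γ) • (1 : Matrix (Fin n) (Fin n) ℝ) - (A + Aᵀ)).PosSemidef)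
    (ΔA : ℝ → Matrix (Fin n) (Fin n) ℝ) (hΔA : Continuous ΔA)
    (Δ : ℝ → EuclideanSpace ℝ (Fin n)) (hΔ : Continuous Δ)
    (c : ℝ → EuclideanSpace ℝ (Fin n))
    (hc : ∀ t, 0 ≤ t → HasDerivAt c
      (Matrix.toEuclideanCLM (𝕜 := ℝ) (Sig⁻¹ * A + ΔA t) (c t) + Δ t) t)
    (ε : ℝ) (hε0 : 0 < ε) (hεγ : ε < γ / lamM) (t : ℝ) (ht : 0 ≤ t) :
    ‖c t‖ ^ 2 ≤
      (lamM / lamm) *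
        Real.exp (-(γ / lamM - ε) * t
          + 2 * Real.sqrt (lamM / lamm) * ∫ s in (0:ℝ)..t, opNorm (ΔA s)) * ‖c 0‖ ^ 2
      + (lamM / (ε * lamm)) * ∫ s in (0:ℝ)..t,
          Real.exp (-(γ / lamM - ε) * (t - s)
            + 2 * Real.sqrt (lamM / lamm) * ∫ τ in s..t, opNorm (ΔA τ)) * ‖Δ s‖ ^ 2 := by
  have hmpos : 0 < lamm := by
    obtain ⟨i, hi⟩ := hlamm.1
    rw [← hi]; exact hSig.eigenvalues_pos i
  have hmM : lamm ≤ lamM := hlamm.2 hlamM.1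
  have hMpos : 0 < lamM := lt_of_lt_of_le hmpos hmM
  obtain ⟨hl, hu⟩ := aux_eig Sig hSig.1 lamm lamM (fun i => hlamm.2 ⟨i, rfl⟩) (fun i => hlamM.2 ⟨i, rfl⟩)
  set S := Matrix.toEuclideanCLM (n := Fin n) (𝕜 := ℝ) Sig with hS
  have hlow : ∀ x, lamm * ‖x‖ ^ 2 ≤ inner ℝ (S x) x := by
    intro x
    have := aux_psd _ hl x
    simp only [map_sub, map_smul, map_one, ContinuousLinearMap.sub_apply, ContinuousLinearMap.smul_apply,
      ContinuousLinearMap.one_apply, inner_sub_left, inner_smul_left, real_inner_self_eq_norm_sq,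
      RCLike.conj_to_real] at this
    linarith
  have hup : ∀ x, inner ℝ (S x) x ≤ lamM * ‖x‖ ^ 2 := by
    intro x
    have := aux_psd _ hu x
    simp only [map_sub, map_smul, map_one, ContinuousLinearMap.sub_apply, ContinuousLinearMap.smul_apply,
      ContinuousLinearMap.one_apply, inner_sub_left, inner_smul_left, real_inner_self_eq_norm_sq,
      RCLike.conj_to_real] at this
    linarith
  have hpos : ∀ x, 0 ≤ inner ℝ (S x) x := fun x => le_trans (by positivity) (hlow x)
  have hST : Sigᵀ = Sig := by simpa [Matrix.IsHermitian] using hSig.1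
  have hsym : ∀ x y, inner ℝ (S x) y = inner ℝ x (S y) := by
    intro x y
    rw [hS, aux_tr, hST]
  have hAx : ∀ x, 2 * inner ℝ (Matrix.toEuclideanCLM (n := Fin n) (𝕜 := ℝ) A x) x ≤ -γ * ‖x‖ ^ 2 := by
    intro x
    have := aux_psd _ hA x
    simp only [map_sub, map_add, map_smul, map_one, ContinuousLinearMap.sub_apply, ContinuousLinearMap.add_apply,
      ContinuousLinearMap.smul_apply,
      ContinuousLinearMap.one_apply, inner_sub_left, inner_add_left, inner_smul_left, real_inner_self_eq_norm_sq,
      RCLike.conj_to_real] at this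
    rw [aux_tr Aᵀ, Matrix.transpose_transpose, real_inner_comm x] at this
    rw [real_inner_comm]
    linarith
  have hdet : IsUnit Sig.det := (Matrix.isUnit_iff_isUnit_det _).1 hSig.isUnit
  have hSA : ∀ x, S (Matrix.toEuclideanCLM (n := Fin n) (𝕜 := ℝ) (Sig⁻¹ * A) x)
      = Matrix.toEuclideanCLM (n := Fin n) (𝕜 := ℝ) A x := by
    intro x
    rw [hS, ← ContinuousLinearMap.mul_apply, ← map_mul, Matrix.mul_nonsing_inv_cancel_left _ _ hdet]
  set κ := Real.sqrt (lamM / lamm) with hκ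
  have hκpos : 0 < κ := Real.sqrt_pos.2 (by positivity)
  have hκ2 : κ ^ 2 = lamM / lamm := Real.sq_sqrt (by positivity)
  have hop : Continuous fun s => opNorm (ΔA s) := aux_cont.comp hΔA
  set V : ℝ → ℝ := fun s => inner ℝ (S (c s)) (c s) with hV
  have dV : ∀ s, 0 ≤ s → HasDerivAt V (2 * inner ℝ (S (c s))
      (Matrix.toEuclideanCLM (𝕜 := ℝ) (Sig⁻¹ * A + ΔA s) (c s) + Δ s)) s := by
    intro s hs
    have h1 := hc s hs
    have h2 := (S.hasFDerivAt.comp_hasDerivAt s h1).inner ℝ h1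
    refine h2.congr_deriv ?_
    rw [hsym (_ + _), real_inner_comm (S _)]
    simp only [Function.comp]
    ring
  have main := aux_gron V _ (fun s => -(γ / lamM - ε) + 2 * κ * opNorm (ΔA s))
    (fun s => lamM / ε * ‖Δ s‖ ^ 2) (by fun_prop) (by fun_prop) dV (by
      intro s hs
      simp only [map_add, ContinuousLinearMap.add_apply, inner_add_right]
      have i1 : 2 * inner ℝ (S (c s)) (Matrix.toEuclideanCLM (n := Fin n) (𝕜 := ℝ) (Sig⁻¹ * A) (c s))
          ≤ -(γ / lamM) * V s := by
        rw [hsym, hSA, real_inner_comm]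
        refine (hAx _).trans ?_
        have := mul_le_mul_of_nonneg_left (hup (c s)) (div_pos hγ hMpos).le
        rw [← mul_assoc, div_mul_cancel₀ _ hMpos.ne'] at this
        simp only [hV]
        linarith
      have i2 : 2 * inner ℝ (S (c s)) (Matrix.toEuclideanCLM (n := Fin n) (𝕜 := ℝ) (ΔA s) (c s))
          ≤ 2 * κ * opNorm (ΔA s) * V s := by
        have hb : ‖Matrix.toEuclideanCLM (n := Fin n) (𝕜 := ℝ) (ΔA s) (c s)‖ ≤ opNorm (ΔA s) * ‖c s‖ :=
          ContinuousLinearMap.le_opNorm _ _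
        generalize Matrix.toEuclideanCLM (n := Fin n) (𝕜 := ℝ) (ΔA s) (c s) = y at hb ⊢
        have ha : 0 ≤ opNorm (ΔA s) := norm_nonneg _
        generalize opNorm (ΔA s) = a at ha hb ⊢
        rcases ha.eq_or_lt with h0 | h0
        · subst h0
          have : y = 0 := by simpa using hb
          simp [this]
        · have h1 := aux_ineq S hsym hpos (κ * a) (by positivity) (c s) y
          have h2 : inner ℝ (S y) y ≤ κ ^ 2 * a ^ 2 * V s := by
            calc inner ℝ (S y) y ≤ lamM * ‖y‖ ^ 2 := hup y
              _ ≤ lamM * (a * ‖c s‖) ^ 2 := by gcongr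
              _ = κ ^ 2 * a ^ 2 * (lamm * ‖c s‖ ^ 2) := by rw [hκ2]; field_simp
              _ ≤ _ := by gcongr; exact hlow _
          have h3 := mul_le_mul_of_nonneg_left h2 (one_div_pos.2 (mul_pos hκpos h0)).le
          have h4 : 1 / (κ * a) * (κ ^ 2 * a ^ 2 * V s) = κ * a * V s := by field_simp
          rw [h4] at h3
          change _ ≤ κ * a * V s + _ at h1
          linarith
      have i3 : 2 * inner ℝ (S (c s)) (Δ s) ≤ ε * V s + lamM / ε * ‖Δ s‖ ^ 2 := by
        have h1 := aux_ineq S hsym hpos ε hε0 (c s) (Δ s)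
        have h3 := mul_le_mul_of_nonneg_left (hup (Δ s)) (one_div_pos.2 hε0).le
        have h4 : 1 / ε * (lamM * ‖Δ s‖ ^ 2) = lamM / ε * ‖Δ s‖ ^ 2 := by ring
        change _ ≤ ε * V s + _ at h1
        linarith
      linarith) t ht
  have hint : ∀ s, ∫ τ in s..t, (-(γ / lamM - ε) + 2 * κ * opNorm (ΔA τ))
      = -(γ / lamM - ε) * (t - s) + 2 * κ * ∫ τ in s..t, opNorm (ΔA τ) := by
    intro s
    rw [intervalIntegral.integral_add (by simp) ((by fun_prop : Continuous fun τ => 2 * κ * opNorm (ΔA τ)).intervalIntegrable _ _),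
      intervalIntegral.integral_const_mul, intervalIntegral.integral_const]
    simp only [smul_eq_mul]
    ring
  simp only [hint, sub_zero] at main
  have e3 : ∀ s, Real.exp (-(γ / lamM - ε) * (t - s) + 2 * κ * ∫ τ in s..t, opNorm (ΔA τ)) * (lamM / ε * ‖Δ s‖ ^ 2)
     = lamM / ε * (Real.exp (-(γ / lamM - ε) * (t - s) + 2 * κ * ∫ τ in s..t, opNorm (ΔA τ)) * ‖Δ s‖ ^ 2) := by
    intro s; ring
  simp only [e3] at main
  rw [intervalIntegral.integral_const_mul] at main
  have h0 := mul_le_mul_of_nonneg_left (hup (c 0))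
    (Real.exp_pos (-(γ / lamM - ε) * t + 2 * κ * ∫ s in (0:ℝ)..t, opNorm (ΔA s))).le
  have h5 := (hlow (c t)).trans (main.trans (add_le_add_left h0 _))
  rw [mul_comm, ← le_div_iff₀ hmpos] at h5
  refine h5.trans (le_of_eq ?_)
  field_simp
end

section
/- Let Σ be a real symmetric positive-definite n×n matrix with largest eigenvalue λ_M and smallest eigenvalue λ_m, and set κ = √(λ_M/λ_m). Let A be a real n×n matrix with A + Aᵀ ⪯ −γ I for some γ > 0. Let ΔA : [0,∞) → ℝ^{n×n} and Δ : [0,∞) → ℝⁿ be continuous, and let c : [0,∞) → ℝⁿ be continuously differentiable and satisfy ċ_t = (Σ⁻¹A + ΔA_t) c_t + Δ_t. Then the Lyapunov function V(c) = cᵀ Σ c satisfies, for every ε > 0 and every t ≥ 0, the differential inequality d/dt V(c_t) ≤ −( γ/λ_M − ε − 2κ |ΔA_t| ) V(c_t) + (1/ε) Δ_tᵀ Σ Δ_t. -/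
open MeasureTheory Matrix RealInnerProductSpace

theorem clm_symm {n : ℕ} (S : Matrix (Fin n) (Fin n) ℝ) (x y : EuclideanSpace ℝ (Fin n)) :
    ⟪x, Matrix.toEuclideanCLM (𝕜 := ℝ) S y⟫ = ⟪Matrix.toEuclideanCLM (𝕜 := ℝ) Sᵀ x, y⟫ := by
  rw [real_inner_comm y, Matrix.inner_toEuclideanCLM, Matrix.inner_toEuclideanCLM,
    Matrix.dotProduct_mulVec, ← Matrix.mulVec_transpose, dotProduct_comm]

theorem clm_eig {n : ℕ} {S : Matrix (Fin n) (Fin n) ℝ} (hS : S.IsHermitian)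
    (i : Fin n) (x : EuclideanSpace ℝ (Fin n)) :
    ⟪hS.eigenvectorBasis i, Matrix.toEuclideanCLM (𝕜 := ℝ) S x⟫ =
      hS.eigenvalues i * ⟪hS.eigenvectorBasis i, x⟫ := by
  have hT : Sᵀ = S := by simpa [Matrix.IsHermitian] using hS
  have h : Matrix.toEuclideanCLM (𝕜 := ℝ) S (hS.eigenvectorBasis i) =
      hS.eigenvalues i • hS.eigenvectorBasis i := by
    apply (WithLp.ofLp_injective 2)
    rw [Matrix.ofLp_toEuclideanCLM, hS.mulVec_eigenvectorBasis]
    rfl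
  rw [clm_symm, hT, h, real_inner_smul_left]

theorem quad_eq {n : ℕ} {S : Matrix (Fin n) (Fin n) ℝ} (hS : S.IsHermitian)
    (x : EuclideanSpace ℝ (Fin n)) :
    ⟪x, Matrix.toEuclideanCLM (𝕜 := ℝ) S x⟫ =
      ∑ i, hS.eigenvalues i * ⟪hS.eigenvectorBasis i, x⟫ ^ 2 := by
  rw [← hS.eigenvectorBasis.sum_inner_mul_inner]
  refine Finset.sum_congr rfl fun i _ => ?_
  rw [clm_eig, real_inner_comm]
  ring

theorem stmt_norm_sq {n : ℕ} {S : Matrix (Fin n) (Fin n) ℝ} (hS : S.IsHermitian)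
    (x : EuclideanSpace ℝ (Fin n)) :
    ‖x‖ ^ 2 = ∑ i, ⟪hS.eigenvectorBasis i, x⟫ ^ 2 :=
  (hS.eigenvectorBasis.sum_sq_inner_right x).symm

theorem stmt3 {n : ℕ} (Sig A : Matrix (Fin n) (Fin n) ℝ)
    (hSig : Sig.PosDef)
    (lamM lamm : ℝ)
    (hlamM : IsGreatest (Set.range hSig.1.eigenvalues) lamM)
    (hlamm : IsLeast (Set.range hSig.1.eigenvalues) lamm)
    (γ : ℝ) (hγ : 0 < γ)
    (hA : ((-γ) • (1 : Matrix (Fin n) (Fin n) ℝ) - (A + Aᵀ)).PosSemidef)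
    (ΔA : ℝ → Matrix (Fin n) (Fin n) ℝ) (hΔA : Continuous ΔA)
    (Δ : ℝ → EuclideanSpace ℝ (Fin n)) (hΔ : Continuous Δ)
    (c : ℝ → EuclideanSpace ℝ (Fin n))
    (hc : ∀ t, 0 ≤ t → HasDerivAt c
      (Matrix.toEuclideanCLM (𝕜 := ℝ) (Sig⁻¹ * A + ΔA t) (c t) + Δ t) t)
    (ε : ℝ) (hε : 0 < ε) (t : ℝ) (ht : 0 ≤ t) :
    deriv (fun u => ⟪c u, Matrix.toEuclideanCLM (𝕜 := ℝ) Sig (c u)⟫) t ≤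
      -(γ / lamM - ε - 2 * Real.sqrt (lamM / lamm) * opNorm (ΔA t)) *
          ⟪c t, Matrix.toEuclideanCLM (𝕜 := ℝ) Sig (c t)⟫
        + (1 / ε) * ⟪Δ t, Matrix.toEuclideanCLM (𝕜 := ℝ) Sig (Δ t)⟫ := by
  have hS := hSig.1
  have hT : Sigᵀ = Sig := by simpa [Matrix.IsHermitian] using hS
  obtain ⟨i0, hi0⟩ := hlamm.1
  have hm0 : 0 < lamm := hi0 ▸ hSig.eigenvalues_pos i0
  have hmM : lamm ≤ lamM := hlamm.2 hlamM.1
  have hM0 : 0 < lamM := hm0.trans_le hmM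
  have hpos := fun i => hSig.eigenvalues_pos i
  have hle : ∀ i, hSig.1.eigenvalues i ≤ lamM := fun i => hlamM.2 ⟨i, rfl⟩
  have hge : ∀ i, lamm ≤ hSig.1.eigenvalues i := fun i => hlamm.2 ⟨i, rfl⟩
  set S := Matrix.toEuclideanCLM (𝕜 := ℝ) Sig with hSdef
  have hVnn : ∀ x : EuclideanSpace ℝ (Fin n), 0 ≤ ⟪x, S x⟫ := fun x => by
    rw [hSdef, quad_eq hSig.1]
    exact Finset.sum_nonneg fun i _ => mul_nonneg (hpos i).le (sq_nonneg _)
  have hV1 : ∀ x : EuclideanSpace ℝ (Fin n), ⟪x, S x⟫ ≤ lamM * ‖x‖ ^ 2 := fun x => by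
    rw [hSdef, quad_eq hSig.1, stmt_norm_sq hSig.1, Finset.mul_sum]
    exact Finset.sum_le_sum fun i _ => mul_le_mul_of_nonneg_right (hle i) (sq_nonneg _)
  have hV2 : ∀ x : EuclideanSpace ℝ (Fin n), lamm * ‖x‖ ^ 2 ≤ ⟪x, S x⟫ := fun x => by
    rw [hSdef, quad_eq hSig.1, stmt_norm_sq hSig.1, Finset.mul_sum]
    exact Finset.sum_le_sum fun i _ => mul_le_mul_of_nonneg_right (hge i) (sq_nonneg _)
  have hV3 : ∀ x : EuclideanSpace ℝ (Fin n), ‖S x‖ ^ 2 ≤ lamM * ⟪x, S x⟫ := fun x => by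
    rw [hSdef, quad_eq hSig.1, stmt_norm_sq hSig.1, Finset.mul_sum]
    refine Finset.sum_le_sum fun i _ => ?_
    rw [clm_eig, mul_pow, sq (hSig.1.eigenvalues i), mul_assoc]
    exact mul_le_mul_of_nonneg_right (hle i) (mul_nonneg (hpos i).le (sq_nonneg _))
  have hsym : ∀ x y : EuclideanSpace ℝ (Fin n), ⟪x, S y⟫ = ⟪S x, y⟫ := fun x y => by
    rw [hSdef, clm_symm, hT]
  have hd := hc t ht
  have hder := (hd.inner ℝ (S.hasFDerivAt.comp_hasDerivAt t hd)).deriv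
  have hder' : deriv (fun u => ⟪c u, S (c u)⟫) t =
      2 * ⟪S (c t), Matrix.toEuclideanCLM (𝕜 := ℝ) (Sig⁻¹ * A + ΔA t) (c t) + Δ t⟫ := by
    refine hder.trans ?_
    simp only [Function.comp]
    rw [hsym, real_inner_comm (S (c t))]
    ring
  rw [hder']
  set x := c t
  set d := Δ t
  set D := Matrix.toEuclideanCLM (𝕜 := ℝ) (ΔA t) with hD
  have hinv : S (Matrix.toEuclideanCLM (𝕜 := ℝ) (Sig⁻¹ * A) x) =
      Matrix.toEuclideanCLM (𝕜 := ℝ) A x := by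
    rw [hSdef, ← ContinuousLinearMap.mul_apply, ← map_mul, ← mul_assoc,
      Matrix.mul_nonsing_inv _ ((Matrix.isUnit_iff_isUnit_det _).1 hSig.isUnit), one_mul]
  have hsplit : ⟪S x, Matrix.toEuclideanCLM (𝕜 := ℝ) (Sig⁻¹ * A + ΔA t) x + d⟫ =
      ⟪x, Matrix.toEuclideanCLM (𝕜 := ℝ) A x⟫ + ⟪S x, D x⟫ + ⟪S x, d⟫ := by
    rw [map_add, ContinuousLinearMap.add_apply, inner_add_right, inner_add_right, ← hsym x, hinv]
  rw [hsplit]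
  have h1 : 2 * ⟪x, Matrix.toEuclideanCLM (𝕜 := ℝ) A x⟫ ≤ -γ * ‖x‖ ^ 2 := by
    have h := hA.dotProduct_mulVec_nonneg (WithLp.ofLp x)
    rw [star_trivial, ← Matrix.inner_toEuclideanCLM] at h
    rw [map_sub, map_add, map_smul, map_one, ContinuousLinearMap.sub_apply,
      ContinuousLinearMap.add_apply, ContinuousLinearMap.smul_apply,
      ContinuousLinearMap.one_apply, inner_sub_right, inner_add_right, real_inner_smul_right,
      real_inner_self_eq_norm_sq, clm_symm Aᵀ, Matrix.transpose_transpose,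
      real_inner_comm x] at h
    linarith
  have h1' : -γ * ‖x‖ ^ 2 ≤ -(γ / lamM) * ⟪x, S x⟫ := by
    have := mul_le_mul_of_nonneg_left (hV1 x) (div_pos hγ hM0).le
    have e : γ / lamM * (lamM * ‖x‖ ^ 2) = γ * ‖x‖ ^ 2 := by field_simp
    linarith
  have hk : ‖S x‖ * ‖x‖ ≤ Real.sqrt (lamM / lamm) * ⟪x, S x⟫ := by
    refine abs_le_of_sq_le_sq' ?_ (mul_nonneg (Real.sqrt_nonneg _) (hVnn x)) |>.2
    rw [mul_pow, mul_pow, Real.sq_sqrt (div_pos hM0 hm0).le]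
    have h2 : ‖x‖ ^ 2 ≤ ⟪x, S x⟫ / lamm := by
      rw [le_div_iff₀ hm0, mul_comm]; exact hV2 x
    calc ‖S x‖ ^ 2 * ‖x‖ ^ 2 ≤ (lamM * ⟪x, S x⟫) * (⟪x, S x⟫ / lamm) :=
          mul_le_mul (hV3 x) h2 (sq_nonneg _) (mul_nonneg hM0.le (hVnn x))
      _ = _ := by ring
  have h2 : ⟪S x, D x⟫ ≤ Real.sqrt (lamM / lamm) * opNorm (ΔA t) * ⟪x, S x⟫ := by
    have ho : opNorm (ΔA t) = ‖D‖ := rfl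
    rw [ho]
    calc ⟪S x, D x⟫ ≤ ‖S x‖ * ‖D x‖ := real_inner_le_norm _ _
      _ ≤ ‖S x‖ * (‖D‖ * ‖x‖) := by gcongr; exact D.le_opNorm x
      _ = ‖D‖ * (‖S x‖ * ‖x‖) := by ring
      _ ≤ ‖D‖ * (Real.sqrt (lamM / lamm) * ⟪x, S x⟫) := by gcongr
      _ = _ := by ring
  have h3 : 2 * ⟪S x, d⟫ ≤ ε * ⟪x, S x⟫ + (1 / ε) * ⟪d, S d⟫ := by
    have h := hVnn (ε • x - d)
    rw [map_sub, map_smul, inner_sub_left, inner_sub_right, inner_sub_right,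
      real_inner_smul_left, real_inner_smul_left, real_inner_smul_right, real_inner_smul_right,
      hsym x d, real_inner_comm (S x) d] at h
    have h' := mul_nonneg (one_div_pos.2 hε).le h
    have e : 1 / ε * (ε * (ε * ⟪x, S x⟫) - ε * ⟪S x, d⟫ - (ε * ⟪S x, d⟫ - ⟪d, S d⟫)) =
      ε * ⟪x, S x⟫ + (1 / ε) * ⟪d, S d⟫ - 2 * ⟪S x, d⟫ := by field_simp; ring
    rw [e] at h'
    linarith
  linarith
end

section
/- For every real a > 0 there exists a constant h > 0 such that for all t ≥ 0, ∫₀ᵗ e^{−a(t−s)} / (s+1) ds ≤ h/(t+1). -/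
theorem stmt7 (a : ℝ) (ha : 0 < a) :
    ∃ h : ℝ, 0 < h ∧ ∀ t, 0 ≤ t →
      (∫ s in (0:ℝ)..t, Real.exp (-a * (t - s)) / (s + 1)) ≤ h / (t + 1) := by
  refine ⟨(1 + 2 / a) * (2 / a), by positivity, fun t ht => ?_⟩
  have hc : Continuous (fun s : ℝ => (1 + 2 / a) / (t + 1) * Real.exp (-(a / 2) * (t - s))) := by
    fun_prop
  have hI : (∫ s in (0:ℝ)..t, (1 + 2 / a) / (t + 1) * Real.exp (-(a / 2) * (t - s)))
      = (1 + 2 / a) / (t + 1) * (2 / a) * Real.exp (-(a / 2) * (t - t))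
        - (1 + 2 / a) / (t + 1) * (2 / a) * Real.exp (-(a / 2) * (t - 0)) := by
    refine intervalIntegral.integral_eq_sub_of_hasDerivAt
      (f := fun s => (1 + 2 / a) / (t + 1) * (2 / a) * Real.exp (-(a / 2) * (t - s)))
      (fun s _ => ?_) (hc.intervalIntegrable _ _)
    have h1 : HasDerivAt (fun s : ℝ => -(a / 2) * (t - s)) (-(a / 2) * (-1)) s :=
      ((hasDerivAt_id s).const_sub t).const_mul _
    have h2 := h1.exp.const_mul ((1 + 2 / a) / (t + 1) * (2 / a))
    have h3 : (1 + 2 / a) / (t + 1) * (2 / a) * (Real.exp (-(a / 2) * (t - s)) * (-(a / 2) * (-1)))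
        = (1 + 2 / a) / (t + 1) * Real.exp (-(a / 2) * (t - s)) := by
      have h4 : 2 / a * (a / 2) = 1 := by field_simp
      linear_combination ((1 + 2 / a) / (t + 1) * Real.exp (-(a / 2) * (t - s))) * h4
    rw [h3] at h2
    exact h2
  have hle : (∫ s in (0:ℝ)..t, Real.exp (-a * (t - s)) / (s + 1)) ≤
      ∫ s in (0:ℝ)..t, (1 + 2 / a) / (t + 1) * Real.exp (-(a / 2) * (t - s)) := by
    refine intervalIntegral.integral_mono_on ht ?_ (hc.intervalIntegrable _ _) ?_
    · apply ContinuousOn.intervalIntegrable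
      rw [Set.uIcc_of_le ht]
      refine ContinuousOn.div (by fun_prop) (by fun_prop) ?_
      intro s hs
      have := hs.1
      positivity
    · intro s hs
      obtain ⟨h0, h1⟩ := hs
      set E := Real.exp (-(a / 2) * (t - s)) with hE
      have hEp : 0 < E := Real.exp_pos _
      have e1 : Real.exp (-a * (t - s)) = E * E := by
        rw [hE, ← Real.exp_add]; congr 1; ring
      have e2 : E * Real.exp (a / 2 * (t - s)) = 1 := by
        rw [hE, ← Real.exp_add, ← Real.exp_zero]; congr 1; ring
      have e3 := Real.add_one_le_exp (a / 2 * (t - s))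
      have hu : 0 ≤ t - s := by linarith
      have e4 : E * (a / 2 * (t - s) + 1) ≤ 1 := by
        have := mul_le_mul_of_nonneg_left e3 hEp.le
        linarith
      have e5 : E * (t + 1) ≤ (1 + 2 / a) * (s + 1) := by
        have p1 : E ≤ 1 := by
          have : 0 ≤ E * (a / 2 * (t - s)) := by positivity
          linarith
        have p2 : E * (t - s) ≤ 2 / a := by
          rw [le_div_iff₀ ha]; nlinarith
        have p3 : 0 < 2 / a := by positivity
        nlinarith
      rw [e1, div_mul_eq_mul_div, div_le_div_iff₀ (by linarith) (by linarith)]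
      nlinarith
  refine hle.trans ?_
  rw [hI, sub_self, mul_zero, Real.exp_zero, mul_one]
  have : 0 ≤ (1 + 2 / a) / (t + 1) * (2 / a) * Real.exp (-(a / 2) * (t - 0)) := by positivity
  have e : (1 + 2 / a) / (t + 1) * (2 / a) = (1 + 2 / a) * (2 / a) / (t + 1) := by ring
  linarith
end

section
/- Let α : [0,∞) → ℝ be differentiable with α_t > 0 and α′_t ≤ 0 for all t. Suppose there exist h > 0 and t₀ ≥ 0 such that α_t² ≥ −h α′_t for all t ≥ t₀. Then for every t ≥ t₀, exp( −∫_{t₀}^{t} α_s ds ) ≤ (α_t / α_{t₀})^{h}. -/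
theorem stmt8 (α α' : ℝ → ℝ)
    (hderiv : ∀ t, 0 ≤ t → HasDerivAt α (α' t) t)
    (hpos : ∀ t, 0 ≤ t → 0 < α t)
    (hdec : ∀ t, 0 ≤ t → α' t ≤ 0)
    (h t₀ : ℝ) (hh : 0 < h) (ht₀ : 0 ≤ t₀)
    (hineq : ∀ t, t₀ ≤ t → α t ^ 2 ≥ -h * α' t) :
    ∀ t, t₀ ≤ t → Real.exp (-∫ s in t₀..t, α s) ≤ (α t / α t₀) ^ h := by
  intro t ht
  have hc : ContinuousOn α (Set.Ici t₀) := fun x hx =>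
    (hderiv x (ht₀.trans hx)).continuousAt.continuousWithinAt
  have hint : ∀ u, t₀ ≤ u → IntervalIntegrable α MeasureTheory.volume t₀ u := by
    intro u hu
    apply ContinuousOn.intervalIntegrable
    rw [Set.uIcc_of_le hu]
    exact hc.mono Set.Icc_subset_Ici_self
  have hder : ∀ x, t₀ < x → HasDerivAt (fun u => (∫ s in t₀..u, α s) + h * Real.log (α u))
      (α x + h * (α' x / α x)) x := by
    intro x hx
    have hx0 := ht₀.trans hx.le
    refine HasDerivAt.add ?_ (((hderiv x hx0).log (hpos x hx0).ne').const_mul h)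
    refine intervalIntegral.integral_hasDerivAt_right (hint x hx.le) ?_
      (hderiv x hx0).continuousAt
    exact (hc.mono Set.Ioi_subset_Ici_self).stronglyMeasurableAtFilter isOpen_Ioi x hx
  have hmono : MonotoneOn (fun u => (∫ s in t₀..u, α s) + h * Real.log (α u))
      (Set.Icc t₀ t) := by
    apply monotoneOn_of_deriv_nonneg (convex_Icc _ _)
    · apply ContinuousOn.add
      · have := intervalIntegral.continuousOn_primitive_interval' (hint t ht)
          (Set.left_mem_uIcc)
        rwa [Set.uIcc_of_le ht] at this
      · apply ContinuousOn.mul continuousOn_const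
        exact (hc.mono Set.Icc_subset_Ici_self).log
          fun x hx => (hpos x (ht₀.trans hx.1)).ne'
    · intro x hx
      rw [interior_Icc] at hx
      exact (hder x hx.1).differentiableAt.differentiableWithinAt
    · intro x hx
      rw [interior_Icc] at hx
      rw [(hder x hx.1).deriv]
      have hp := hpos x (ht₀.trans hx.1.le)
      have h2 := hineq x hx.1.le
      have : α x + h * (α' x / α x) = (α x ^ 2 + h * α' x) / α x := by
        field_simp
      rw [this]
      apply div_nonneg _ hp.le
      linarith
  have key := hmono (Set.left_mem_Icc.2 ht) (Set.right_mem_Icc.2 ht) ht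
  simp only [intervalIntegral.integral_same] at key
  have p0 := hpos t₀ ht₀
  have p1 := hpos t (ht₀.trans ht)
  rw [Real.rpow_def_of_pos (div_pos p1 p0), Real.log_div p1.ne' p0.ne']
  apply Real.exp_le_exp.2
  linarith
end

section
/- Let A be a real N×N matrix with A + Aᵀ ⪯ −2γ I for some γ > 0, let b ∈ ℝᴺ, and let c* ∈ ℝᴺ satisfy A c* + b = 0. Let α : [0,∞) → (0,∞) be continuous and let ĉ : [0,∞) → ℝᴺ be differentiable with ĉ′_t = α_t (A ĉ_t + b) for all t ≥ 0. Then |ĉ_t − c*|² ≤ exp( −2γ ∫₀ᵗ α_s ds ) · |ĉ₀ − c*|² for all t ≥ 0. Moreover, if ∫₀^∞ α_t dt = ∞, then ĉ_t → c* as t → ∞. -/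
open Matrix Filter

theorem quad_aux {N : ℕ} (A : Matrix (Fin N) (Fin N) ℝ) (γ : ℝ)
    (hA : ((-(2 * γ)) • (1 : Matrix (Fin N) (Fin N) ℝ) - (A + Aᵀ)).PosSemidef)
    (x : EuclideanSpace ℝ (Fin N)) :
    inner ℝ x (Matrix.toEuclideanCLM (𝕜 := ℝ) A x) ≤ -γ * ‖x‖ ^ 2 := by
  have h := hA.dotProduct_mulVec_nonneg x.ofLp
  have e1 : inner ℝ x (Matrix.toEuclideanCLM (𝕜 := ℝ) A x) = x.ofLp ⬝ᵥ (A *ᵥ x.ofLp) := by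
    rw [EuclideanSpace.inner_eq_star_dotProduct, Matrix.ofLp_toEuclideanCLM, dotProduct_comm]
    simp
  have e2 : ‖x‖ ^ 2 = x.ofLp ⬝ᵥ x.ofLp := by
    rw [← real_inner_self_eq_norm_sq, EuclideanSpace.inner_eq_star_dotProduct]
    simp
  have e3 : x.ofLp ⬝ᵥ (Aᵀ *ᵥ x.ofLp) = x.ofLp ⬝ᵥ (A *ᵥ x.ofLp) := by
    rw [Matrix.mulVec_transpose, dotProduct_comm, Matrix.dotProduct_mulVec]
  simp only [star_trivial, sub_mulVec, add_mulVec, smul_mulVec, one_mulVec, dotProduct_sub,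
    dotProduct_add, dotProduct_smul, e3, smul_eq_mul] at h
  rw [e1, e2]
  linarith

theorem int_aux (α : ℝ → ℝ) (hαcont : Continuous α) (hαpos : ∀ t, 0 ≤ t → 0 < α t)
    (h : (∫⁻ t in Set.Ioi (0:ℝ), ENNReal.ofReal (α t)) = ⊤) :
    Tendsto (fun t => ∫ s in (0:ℝ)..t, α s) atTop atTop := by
  have hmono : Monotone (fun t => ∫ s in (0:ℝ)..(max t 0), α s) := by
    intro a b hab
    have hab' : max a 0 ≤ max b 0 := max_le_max_right 0 hab
    have h1 := intervalIntegral.integral_add_adjacent_intervals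
      (hαcont.intervalIntegrable (μ := MeasureTheory.volume) 0 (max a 0))
      (hαcont.intervalIntegrable (μ := MeasureTheory.volume) (max a 0) (max b 0))
    have h2 : 0 ≤ ∫ s in (max a 0)..(max b 0), α s :=
      intervalIntegral.integral_nonneg hab' fun u hu =>
        (hαpos u ((le_max_right _ _).trans hu.1)).le
    simp only
    linarith
  have heq : (fun t => ∫ s in (0:ℝ)..(max t 0), α s) =ᶠ[atTop] fun t => ∫ s in (0:ℝ)..t, α s := by
    filter_upwards [eventually_ge_atTop 0] with t ht
    rw [max_eq_left ht]
  rcases tendsto_atTop_of_monotone hmono with h1 | ⟨l, h1⟩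
  · exact h1.congr' heq
  · exfalso
    have h2 := h1.congr' heq
    have h3 : MeasureTheory.IntegrableOn α (Set.Ioi 0) := by
      refine MeasureTheory.integrableOn_Ioi_of_intervalIntegral_norm_tendsto l 0
        (b := id) (l := atTop) (fun i => hαcont.integrableOn_Ioc) tendsto_id ?_
      refine h2.congr' ?_
      filter_upwards [eventually_ge_atTop 0] with t ht
      refine intervalIntegral.integral_congr fun s hs => ?_
      rw [Set.uIcc_of_le ht] at hs
      exact (Real.norm_of_nonneg (hαpos s hs.1).le).symm
    exact h3.lintegral_lt_top.ne h

theorem stmt10 {N : ℕ} (A : Matrix (Fin N) (Fin N) ℝ) (γ : ℝ) (hγ : 0 < γ)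
    (hA : ((-(2 * γ)) • (1 : Matrix (Fin N) (Fin N) ℝ) - (A + Aᵀ)).PosSemidef)
    (b cstar : EuclideanSpace ℝ (Fin N))
    (hcstar : Matrix.toEuclideanCLM (𝕜 := ℝ) A cstar + b = 0)
    (α : ℝ → ℝ) (hαcont : Continuous α) (hαpos : ∀ t, 0 ≤ t → 0 < α t)
    (c : ℝ → EuclideanSpace ℝ (Fin N))
    (hc : ∀ t, 0 ≤ t →
      HasDerivAt c (α t • (Matrix.toEuclideanCLM (𝕜 := ℝ) A (c t) + b)) t) :
    (∀ t, 0 ≤ t →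
      ‖c t - cstar‖ ^ 2 ≤ Real.exp (-2 * γ * ∫ s in (0:ℝ)..t, α s) * ‖c 0 - cstar‖ ^ 2) ∧
    ((∫⁻ t in Set.Ioi (0:ℝ), ENNReal.ofReal (α t)) = ⊤ →
      Tendsto c atTop (nhds cstar)) := by
  have hbound : ∀ t, 0 ≤ t →
      ‖c t - cstar‖ ^ 2 ≤ Real.exp (-2 * γ * ∫ s in (0:ℝ)..t, α s) * ‖c 0 - cstar‖ ^ 2 := by
    have hb : b = -(Matrix.toEuclideanCLM (𝕜 := ℝ) A cstar) := (neg_eq_of_add_eq_zero_right hcstar).symm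
    have hd : ∀ t, 0 ≤ t → HasDerivAt
        (fun t => Real.exp (2 * γ * ∫ s in (0:ℝ)..t, α s) * ‖c t - cstar‖ ^ 2)
        (Real.exp (2 * γ * ∫ s in (0:ℝ)..t, α s) * (2 * γ * α t) * ‖c t - cstar‖ ^ 2
          + Real.exp (2 * γ * ∫ s in (0:ℝ)..t, α s) *
            (2 * inner ℝ (c t - cstar)
              (α t • (Matrix.toEuclideanCLM (𝕜 := ℝ) A (c t) + b)))) t := by
      intro t ht
      have hI : HasDerivAt (fun t => ∫ s in (0:ℝ)..t, α s) (α t) t :=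
        hαcont.integral_hasStrictDerivAt 0 t |>.hasDerivAt
      exact ((hI.const_mul (2 * γ)).exp).mul (((hc t ht).sub_const cstar).norm_sq)
    have hanti : AntitoneOn
        (fun t => Real.exp (2 * γ * ∫ s in (0:ℝ)..t, α s) * ‖c t - cstar‖ ^ 2) (Set.Ici 0) := by
      refine antitoneOn_of_deriv_nonpos (convex_Ici 0)
        (fun t ht => (hd t ht).continuousAt.continuousWithinAt) ?_ ?_
      · intro t ht
        rw [interior_Ici] at ht
        exact (hd t (le_of_lt ht)).differentiableAt.differentiableWithinAt
      · intro t ht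
        rw [interior_Ici] at ht
        have ht' : 0 ≤ t := le_of_lt ht
        rw [(hd t ht').deriv]
        have hq := quad_aux A γ hA (c t - cstar)
        rw [hb, ← sub_eq_add_neg, ← map_sub, real_inner_smul_right]
        have h1 := mul_le_mul_of_nonneg_left hq
          (mul_nonneg (Real.exp_pos (2 * γ * ∫ s in (0:ℝ)..t, α s)).le (hαpos t ht').le)
        linarith
    intro t ht
    have h := hanti (Set.mem_Ici.2 le_rfl) (Set.mem_Ici.2 ht) ht
    simp only [intervalIntegral.integral_same, mul_zero, Real.exp_zero, one_mul] at h
    have h2 := mul_le_mul_of_nonneg_left h (Real.exp_pos (-2 * γ * ∫ s in (0:ℝ)..t, α s)).le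
    rw [← mul_assoc, ← Real.exp_add] at h2
    have h3 : (-2 * γ * ∫ s in (0:ℝ)..t, α s) + 2 * γ * ∫ s in (0:ℝ)..t, α s = 0 := by ring
    rwa [h3, Real.exp_zero, one_mul] at h2
  refine ⟨hbound, fun h => ?_⟩
  have hI := int_aux α hαcont hαpos h
  have h1 : Tendsto (fun t => -2 * γ * ∫ s in (0:ℝ)..t, α s) atTop atBot :=
    hI.const_mul_atTop_of_neg (by linarith)
  have h2 := (Real.tendsto_exp_atBot.comp h1).mul_const (‖c 0 - cstar‖ ^ 2)
  rw [zero_mul] at h2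
  have h3 : Tendsto (fun t => ‖c t - cstar‖ ^ 2) atTop (nhds 0) := by
    refine tendsto_of_tendsto_of_tendsto_of_le_of_le' tendsto_const_nhds h2
      (Eventually.of_forall fun t => by positivity) ?_
    filter_upwards [eventually_ge_atTop 0] with t ht
    exact hbound t ht
  rw [tendsto_iff_norm_sub_tendsto_zero]
  have h4 := (Real.continuous_sqrt.tendsto 0).comp h3
  rw [Real.sqrt_zero] at h4
  refine h4.congr fun t => ?_
  simp [Real.sqrt_sq (norm_nonneg _)]
end
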